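/- Let 0<ν<1, α>0, μ>0, and define p̂₀(t) = (α E_ν(−(α+μ) t^ν) + μ)/(α+μ) and p̂₁(t) = α(1 − E_ν(−(α+μ) t^ν))/(α+μ). Then p̂₀(0)=1, p̂₁(0)=0, p̂₀(t)+p̂₁(t)=1 for all t≥0, and for every t>0 the Caputo fractional derivatives satisfy (D^ν p̂₀)(t) = −α p̂₀(t) + μ p̂₁(t) and (D^ν p̂₁)(t) = α p̂₀(t) − μ p̂₁(t). That is, p̂₀, p̂₁ are the state probabilities of the time-fractional linear death process with immigration. -/

import Mathlib

open MeasureTheory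

/-- The Mittag-Leffler function `E_ν(x) = ∑_{k≥0} x^k / Γ(kν+1)`. -/
noncomputable def ML (ν x : ℝ) : ℝ := ∑' k : ℕ, x ^ k / Real.Gamma ((k : ℝ) * ν + 1)

/-- The Caputo fractional derivative of order `ν ∈ (0,1)`. -/
noncomputable def caputo (ν : ℝ) (f : ℝ → ℝ) (t : ℝ) : ℝ :=
  (1 / Real.Gamma (1 - ν)) * ∫ s in (0:ℝ)..t, deriv f s * (t - s) ^ (-ν)

lemma gamma_lower {s R : ℝ} (hs : 0 ≤ s) (hR : 0 < R) :
    R ^ s * Real.exp (-R) ≤ Real.Gamma (s + 1) := by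
  rw [Real.Gamma_eq_integral (by linarith)]
  have hint := Real.GammaIntegral_convergent (s := s + 1) (by linarith)
  have hsub : Set.Ioi R ⊆ Set.Ioi 0 := Set.Ioi_subset_Ioi hR.le
  calc R ^ s * Real.exp (-R) = ∫ x in Set.Ioi R, R ^ s * Real.exp (-x) := by
        rw [integral_const_mul, integral_exp_neg_Ioi]
    _ ≤ ∫ x in Set.Ioi R, Real.exp (-x) * x ^ (s + 1 - 1) := by
        refine setIntegral_mono_on ?_ (hint.mono_set hsub) measurableSet_Ioi ?_
        · exact (integrableOn_exp_neg_Ioi R).const_mul _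
        · intro x hx
          rw [mul_comm, add_sub_cancel_right]
          have : R ≤ x := le_of_lt hx
          gcongr
    _ ≤ _ := by
        refine setIntegral_mono_set hint ?_ hsub.eventuallyLE
        filter_upwards [self_mem_ae_restrict measurableSet_Ioi] with x hx
        have : 0 < x := hx
        simp only [Pi.zero_apply]
        positivity

lemma ml_gpos {ν : ℝ} (hν : 0 < ν) (k : ℕ) : 0 < Real.Gamma ((k : ℝ) * ν + 1) :=
  Real.Gamma_pos_of_pos (by positivity)

lemma ml_summable {ν : ℝ} (hν : 0 < ν) (x : ℝ) (hx : 0 ≤ x) :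
    Summable (fun k : ℕ => x ^ k / Real.Gamma ((k : ℝ) * ν + 1)) := by
  set R : ℝ := (2 * x + 1) ^ (1 / ν) with hRdef
  have hR : 0 < R := by positivity
  have hRν : R ^ ν = 2 * x + 1 := by
    rw [hRdef, ← Real.rpow_mul (by positivity), one_div_mul_cancel hν.ne', Real.rpow_one]
  have hq : x / (2 * x + 1) < 1 := by
    rw [div_lt_one (by positivity)]; linarith
  refine Summable.of_nonneg_of_le (fun k => div_nonneg (by positivity) (ml_gpos hν k).le) ?_
    ((summable_geometric_of_lt_one (by positivity) hq).mul_left (Real.exp R))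
  intro k
  have h := gamma_lower (s := k * ν) (by positivity) hR
  rw [mul_comm (k : ℝ) ν, Real.rpow_mul hR.le, hRν, Real.rpow_natCast] at h
  rw [mul_comm (k : ℝ) ν]
  calc _ ≤ x ^ k / ((2 * x + 1) ^ k * Real.exp (-R)) := by gcongr
    _ = _ := by rw [div_pow, Real.exp_neg]; field_simp

lemma ml_hasDerivAt {ν : ℝ} (hν : 0 < ν) (x : ℝ) :
    HasDerivAt (ML ν) (∑' k : ℕ, (k : ℝ) * x ^ (k - 1) / Real.Gamma ((k : ℝ) * ν + 1)) x := by
  set R : ℝ := |x| + 1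
  have hR : 1 ≤ R := by simp [R]
  have key := hasDerivAt_tsum_of_isPreconnected
    (g := fun (k : ℕ) (y : ℝ) => y ^ k / Real.Gamma ((k : ℝ) * ν + 1))
    (g' := fun (k : ℕ) (y : ℝ) => (k : ℝ) * y ^ (k - 1) / Real.Gamma ((k : ℝ) * ν + 1))
    (t := Metric.ball 0 R) (y₀ := 0) (y := x)
    (ml_summable hν (2 * R) (by positivity)) Metric.isOpen_ball
    (convex_ball (0 : ℝ) R).isPreconnected ?_ ?_ ?_ ?_ ?_
  · exact key
  · intro k y _
    exact (hasDerivAt_pow k y).div_const _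
  · intro k y hy
    have hy' : |y| ≤ R := by
      simpa using (le_of_lt (mem_ball_zero_iff.1 hy))
    have hg := ml_gpos hν k
    rw [Real.norm_eq_abs, abs_div, abs_of_pos hg, abs_mul, abs_pow, Nat.abs_cast, mul_pow]
    have h2 : (k : ℝ) ≤ 2 ^ k := by exact_mod_cast (Nat.lt_two_pow_self (n := k)).le
    gcongr
    calc |y| ^ (k - 1) ≤ R ^ (k - 1) := by gcongr
      _ ≤ R ^ k := pow_le_pow_right₀ hR (Nat.sub_le _ _)
  · simp; positivity
  · refine summable_of_ne_finset_zero (s := {0}) ?_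
    intro k hk
    simp at hk
    simp [hk]
  · simp [R]

lemma ml_hasSum_deriv {ν : ℝ} (hν : 0 < ν) (x : ℝ) :
    Summable (fun k : ℕ => (k : ℝ) * x ^ (k - 1) / Real.Gamma ((k : ℝ) * ν + 1)) := by
  set R : ℝ := |x| + 1
  have hR : 1 ≤ R := by simp [R]
  refine Summable.of_norm_bounded (ml_summable hν (2 * R) (by positivity)) ?_
  intro k
  have hy' : |x| ≤ R := by simp [R]
  have hg := ml_gpos hν k
  rw [Real.norm_eq_abs, abs_div, abs_of_pos hg, abs_mul, abs_pow, Nat.abs_cast, mul_pow]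
  have h2 : (k : ℝ) ≤ 2 ^ k := by exact_mod_cast (Nat.lt_two_pow_self (n := k)).le
  gcongr
  calc |x| ^ (k - 1) ≤ R ^ (k - 1) := by gcongr
    _ ≤ R ^ k := pow_le_pow_right₀ hR (Nat.sub_le _ _)

lemma beta_int {a b t : ℝ} (ha : 0 < a) (hb : 0 < b) (ht : 0 < t) :
    ∫ s in Set.Ioc 0 t, s ^ (a - 1) * (t - s) ^ (b - 1) =
      t ^ (a + b - 1) * (Real.Gamma a * Real.Gamma b / Real.Gamma (a + b)) := by
  have h := Complex.betaIntegral_scaled (a : ℂ) (b : ℂ) ht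
  rw [Complex.betaIntegral_eq_Gamma_mul_div _ _ (by simpa) (by simpa),
    intervalIntegral.integral_of_le ht.le] at h
  have h2 : ∫ s in Set.Ioc 0 t, (s : ℂ) ^ ((a : ℂ) - 1) * ((t : ℂ) - s) ^ ((b : ℂ) - 1)
      = ∫ s in Set.Ioc 0 t, ((s ^ (a - 1) * (t - s) ^ (b - 1) : ℝ) : ℂ) := by
    refine setIntegral_congr_fun measurableSet_Ioc fun s hs => ?_
    have h0 : 0 ≤ t - s := by linarith [hs.2]
    rw [Complex.ofReal_mul, Complex.ofReal_cpow hs.1.le, Complex.ofReal_cpow h0]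
    push_cast
    rfl
  rw [h2, integral_complex_ofReal, ← Complex.ofReal_add, Complex.Gamma_ofReal,
    Complex.Gamma_ofReal, Complex.Gamma_ofReal, ← Complex.ofReal_one, ← Complex.ofReal_sub,
    ← Complex.ofReal_cpow ht.le] at h
  exact_mod_cast h

lemma ml_comp_deriv {ν : ℝ} (hν : 0 < ν) (c : ℝ) {s : ℝ} (hs : 0 < s) :
    HasDerivAt (fun s => ML ν (-c * s ^ ν))
      (∑' n : ℕ, (-c) ^ (n + 1) / Real.Gamma (((n : ℝ) + 1) * ν) *
        s ^ (((n : ℝ) + 1) * ν - 1)) s := by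
  have h := (ml_hasDerivAt hν (-c * s ^ ν)).comp s
    ((Real.hasDerivAt_rpow_const (p := ν) (Or.inl hs.ne')).const_mul (-c))
  convert! h using 1
  rw [(ml_hasSum_deriv hν _).tsum_eq_zero_add]
  simp only [Nat.cast_zero, zero_mul, zero_div, zero_add]
  rw [← tsum_mul_right]
  refine tsum_congr fun n => ?_
  have hn : ((n : ℝ) + 1) * ν ≠ 0 := by positivity
  have hg : Real.Gamma (((n : ℝ) + 1) * ν) ≠ 0 := (Real.Gamma_pos_of_pos (by positivity)).ne'
  push_cast
  rw [Real.Gamma_add_one hn]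
  have : s ^ (((n : ℝ) + 1) * ν - 1) = (s ^ ν) ^ n * s ^ (ν - 1) := by
    rw [← Real.rpow_natCast, ← Real.rpow_mul hs.le, ← Real.rpow_add hs]
    congr 1; ring
  rw [this, mul_pow, pow_succ (-c) n]
  field_simp

lemma caputo_ml {ν c : ℝ} (hν : 0 < ν) (hν1 : ν < 1) {t : ℝ} (ht : 0 < t) :
    ∫ s in (0:ℝ)..t, deriv (fun s => ML ν (-c * s ^ ν)) s * (t - s) ^ (-ν) =
      Real.Gamma (1 - ν) * (-c * ML ν (-c * t ^ ν)) := by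
  rw [intervalIntegral.integral_of_le ht.le]
  set F : ℕ → ℝ → ℝ := fun n s => (-c) ^ (n + 1) / Real.Gamma (((n : ℝ) + 1) * ν) *
    (s ^ (((n : ℝ) + 1) * ν - 1) * (t - s) ^ ((1 - ν) - 1)) with hF
  have hG1 : 0 < Real.Gamma (1 - ν) := Real.Gamma_pos_of_pos (by linarith)
  have hB : ∀ n : ℕ, ∫ s in Set.Ioc 0 t, (s ^ (((n : ℝ) + 1) * ν - 1) * (t - s) ^ ((1 - ν) - 1))
      = (t ^ ν) ^ n * (Real.Gamma (((n : ℝ) + 1) * ν) * Real.Gamma (1 - ν) /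
        Real.Gamma ((n : ℝ) * ν + 1)) := by
    intro n
    rw [beta_int (by positivity) (by linarith) ht, ← Real.rpow_natCast, ← Real.rpow_mul ht.le]
    rw [show ((n : ℝ) + 1) * ν + (1 - ν) = (n : ℝ) * ν + 1 by ring,
      show (n : ℝ) * ν + 1 - 1 = ν * (n : ℝ) by ring]
  have hgn : ∀ n : ℕ, 0 < Real.Gamma (((n : ℝ) + 1) * ν) := fun n =>
    Real.Gamma_pos_of_pos (by positivity)
  have hI : ∀ n : ℕ, IntegrableOn
      (fun s => s ^ (((n : ℝ) + 1) * ν - 1) * (t - s) ^ ((1 - ν) - 1)) (Set.Ioc 0 t) := by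
    intro n
    by_contra hcon
    have h0 := integral_undef hcon
    rw [hB n] at h0
    have := hgn n
    have := ml_gpos hν n
    have : 0 < (t ^ ν) ^ n * (Real.Gamma (((n : ℝ) + 1) * ν) * Real.Gamma (1 - ν) /
        Real.Gamma ((n : ℝ) * ν + 1)) := by positivity
    linarith
  have hFI : ∀ n, Integrable (F n) (volume.restrict (Set.Ioc 0 t)) := fun n =>
    (hI n).const_mul _
  have hN : ∀ n, ∫ s in Set.Ioc 0 t, ‖F n s‖ =
      |c| * Real.Gamma (1 - ν) * ((|c| * t ^ ν) ^ n / Real.Gamma ((n : ℝ) * ν + 1)) := by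
    intro n
    have : ∫ s in Set.Ioc 0 t, ‖F n s‖ = ∫ s in Set.Ioc 0 t,
        |c| ^ (n + 1) / Real.Gamma (((n : ℝ) + 1) * ν) *
    (s ^ (((n : ℝ) + 1) * ν - 1) * (t - s) ^ ((1 - ν) - 1)) := by
      refine setIntegral_congr_fun measurableSet_Ioc fun s hs => ?_
      have h0 : 0 ≤ t - s := by linarith [hs.2]
      have h1 : 0 ≤ s := hs.1.le
      simp only [hF]
      rw [Real.norm_eq_abs, abs_mul, abs_div, abs_pow, abs_neg, abs_of_pos (hgn n),
        abs_of_nonneg (a := s ^ _ * _) (by positivity)]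
    rw [this, integral_const_mul, hB]
    have := (hgn n).ne'
    rw [mul_pow, pow_succ]
    field_simp
  have hS := hasSum_integral_of_summable_integral_norm hFI (by
    simp_rw [hN]
    exact (ml_summable hν _ (by positivity)).mul_left _)
  have hD : ∫ s in Set.Ioc 0 t, deriv (fun s => ML ν (-c * s ^ ν)) s * (t - s) ^ (-ν) =
      ∫ s in Set.Ioc 0 t, ∑' n, F n s := by
    refine setIntegral_congr_fun measurableSet_Ioc fun s hs => ?_
    simp only [hF]
    rw [(ml_comp_deriv hν c hs.1).deriv, ← tsum_mul_right]
    refine tsum_congr fun n => ?_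
    rw [show (1 - ν) - 1 = -ν by ring, mul_assoc]
  rw [hD, ← hS.tsum_eq, ML, ← tsum_mul_left, ← tsum_mul_left]
  refine tsum_congr fun n => ?_
  simp only [hF]
  rw [integral_const_mul, hB, mul_pow, pow_succ]
  have := (hgn n).ne'
  field_simp

lemma ml_zero (ν : ℝ) : ML ν 0 = 1 := by
  rw [ML, tsum_eq_single 0]
  · simp
  · intro k hk; simp [hk]

/-- `p̂₀(t) = (α E_ν(−(α+μ)t^ν) + μ)/(α+μ)` and `p̂₁(t) = α(1 − E_ν(−(α+μ)t^ν))/(α+μ)`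
are the state probabilities of the time-fractional linear death process with
immigration. -/
theorem tfldpwi_state_probabilities (ν α μ : ℝ) (hν0 : 0 < ν) (hν1 : ν < 1)
    (hα : 0 < α) (hμ : 0 < μ) :
    (fun t : ℝ => (α * ML ν (-(α + μ) * t ^ ν) + μ) / (α + μ)) 0 = 1 ∧
    (fun t : ℝ => α * (1 - ML ν (-(α + μ) * t ^ ν)) / (α + μ)) 0 = 0 ∧
    (∀ t : ℝ, 0 ≤ t →
      (α * ML ν (-(α + μ) * t ^ ν) + μ) / (α + μ)
        + α * (1 - ML ν (-(α + μ) * t ^ ν)) / (α + μ) = 1) ∧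
    (∀ t : ℝ, 0 < t →
      caputo ν (fun s => (α * ML ν (-(α + μ) * s ^ ν) + μ) / (α + μ)) t =
        -α * ((α * ML ν (-(α + μ) * t ^ ν) + μ) / (α + μ))
          + μ * (α * (1 - ML ν (-(α + μ) * t ^ ν)) / (α + μ))) ∧
    (∀ t : ℝ, 0 < t →
      caputo ν (fun s => α * (1 - ML ν (-(α + μ) * s ^ ν)) / (α + μ)) t =
        α * ((α * ML ν (-(α + μ) * t ^ ν) + μ) / (α + μ))
          - μ * (α * (1 - ML ν (-(α + μ) * t ^ ν)) / (α + μ))) := by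
  have hc : α + μ ≠ 0 := by positivity
  have hG1 : Real.Gamma (1 - ν) ≠ 0 := (Real.Gamma_pos_of_pos (by linarith)).ne'
  refine ⟨?_, ?_, ?_, ?_, ?_⟩
  · simp only [Real.zero_rpow hν0.ne', mul_zero, ml_zero]
    field_simp
  · simp only [Real.zero_rpow hν0.ne', mul_zero, ml_zero]
    simp
  · intro t _
    field_simp
    ring
  · intro t ht
    have hd : ∀ s, deriv (fun s => (α * ML ν (-(α + μ) * s ^ ν) + μ) / (α + μ)) s =
        α / (α + μ) * deriv (fun s => ML ν (-(α + μ) * s ^ ν)) s := by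
      intro s
      rw [deriv_div_const, deriv_add_const, deriv_const_mul_field]
      ring
    simp only [caputo, hd, mul_assoc]
    rw [intervalIntegral.integral_const_mul, caputo_ml hν0 hν1 ht]
    field_simp
    ring
  · intro t ht
    have hd : ∀ s, deriv (fun s => α * (1 - ML ν (-(α + μ) * s ^ ν)) / (α + μ)) s =
        -(α / (α + μ)) * deriv (fun s => ML ν (-(α + μ) * s ^ ν)) s := by
      intro s
      rw [deriv_div_const, deriv_const_mul_field, deriv_const_sub]
      ring
    simp only [caputo, hd, mul_assoc]
    rw [intervalIntegral.integral_const_mul, caputo_ml hν0 hν1 ht]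
    field_simp
    ring
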